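/- arXiv:2402.00792 — 5 statements merged into one kernel-verified Lean document; each statement's English description precedes it below -/
import Mathlib

section
/- Let A be a unital C*-algebra, let N ≥ 1, and let x₁,…,x_N and y₁,…,y_N be elements of A such that [x_j, y_k] = 0 whenever j ≠ k, and such that ‖x_k‖ ≤ a and ‖y_k‖ ≤ b for all k. Then the average operators X_N = (1/N)∑_{k=1}^N x_k and Y_N = (1/N)∑_{k=1}^N y_k satisfy ‖[X_N, Y_N]‖ ≤ 2ab/N. -/
/-- The commutator of two elements has norm at most twice the product of their norms. -/
theorem norm_commutator_le {A : Type*} [NormedRing A] (u v : A) :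
    ‖⁅u, v⁆‖ ≤ 2 * ‖u‖ * ‖v‖ := by
  rw [Ring.lie_def]
  linarith [norm_sub_le (u * v) (v * u), norm_mul_le u v, norm_mul_le v u]

/-- For families commuting at different sites, only the diagonal terms contribute to the
commutator of the sums. -/
theorem commutator_sum_sum_eq_sum {A ι : Type*} [Ring A] [Fintype ι] {x y : ι → A}
    (hcomm : ∀ j k, j ≠ k → ⁅x j, y k⁆ = 0) :
    ⁅∑ k, x k, ∑ k, y k⁆ = ∑ k, ⁅x k, y k⁆ := by
  rw [LieRing.of_associative_ring_bracket, Finset.sum_mul_sum, Finset.sum_mul_sum,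
    Finset.sum_comm (f := fun i j => y i * x j), ← Finset.sum_sub_distrib]
  refine Finset.sum_congr rfl fun j _ => ?_
  rw [← Finset.sum_sub_distrib]
  exact Finset.sum_eq_single j (fun k _ hk => hcomm j k hk.symm) (by simp)

/-- In a unital C*-algebra, average operators built from families of uniformly
bounded elements commuting at different sites have commutator of norm at most `2ab/N`. -/
theorem average_operators_commutator_bound
    {A : Type*} [NormedRing A] [StarRing A] [CStarRing A]
    [NormedAlgebra ℂ A] [StarModule ℂ A] [CompleteSpace A]
    (N : ℕ) (hN : 1 ≤ N) (x y : Fin N → A) (a b : ℝ)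
    (hcomm : ∀ j k : Fin N, j ≠ k → ⁅x j, y k⁆ = 0)
    (hx : ∀ k, ‖x k‖ ≤ a) (hy : ∀ k, ‖y k‖ ≤ b) :
    ‖⁅(N : ℂ)⁻¹ • ∑ k, x k, (N : ℂ)⁻¹ • ∑ k, y k⁆‖ ≤ 2 * a * b / N := by
  have hN' : (0 : ℝ) < N := by exact_mod_cast hN
  have hsum : ‖∑ k, ⁅x k, y k⁆‖ ≤ N * (2 * a * b) := by
    refine (norm_sum_le_of_le _ fun k _ => ?_).trans_eq (by simp : ∑ _k : Fin N, 2 * a * b = _)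
    have ha : 0 ≤ a := (norm_nonneg _).trans (hx k)
    refine (norm_commutator_le _ _).trans ?_
    gcongr
    exacts [hx k, hy k]
  have hsmul : ⁅(N : ℂ)⁻¹ • ∑ k, x k, (N : ℂ)⁻¹ • ∑ k, y k⁆
      = ((N : ℂ)⁻¹ * (N : ℂ)⁻¹) • ∑ k, ⁅x k, y k⁆ := by
    rw [← commutator_sum_sum_eq_sum hcomm]
    simp only [Ring.lie_def, smul_mul_smul_comm, smul_sub]
  rw [hsmul, norm_smul, norm_mul, norm_inv, Complex.norm_natCast]
  calc (N : ℝ)⁻¹ * (N : ℝ)⁻¹ * ‖∑ k, ⁅x k, y k⁆‖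
      ≤ (N : ℝ)⁻¹ * (N : ℝ)⁻¹ * (N * (2 * a * b)) := by gcongr
    _ = 2 * a * b / N := by field_simp
end

section
/- Let A be a unital Banach algebra, let (c_n)_{n≥0} be complex coefficients, let δ > 0 be such that γ'(δ) := ∑_{n≥0} n|c_n|δ^{n−1} converges, and let N ≥ 1. Let d₁,…,d_N ∈ A with ‖d_k‖ ≤ δ for all k, set Δ_N = (1/N)∑_{k=1}^N d_k, and let O ∈ A. Suppose there is a subset S ⊆ {1,…,N} with |S| = N_O such that [d_k, O] = 0 for every k ∉ S. Then, with Γ(Δ_N) = ∑_{n≥0} c_n Δ_N^n, one has ‖[Γ(Δ_N), O]‖ ≤ (2 N_O / N) ‖O‖ δ γ'(δ). -/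
theorem norm_lie_pow_le {A : Type*} [NormedRing A] [NormOneClass A] {x : A} {δ : ℝ}
    (hx : ‖x‖ ≤ δ) (y : A) (n : ℕ) :
    ‖⁅x ^ n, y⁆‖ ≤ n * δ ^ (n - 1) * ‖⁅x, y⁆‖ := by
  have hδ : 0 ≤ δ := (norm_nonneg x).trans hx
  induction n with
  | zero => simp [Ring.lie_def]
  | succ n ih =>
    have hsplit : ⁅x ^ (n + 1), y⁆ = x ^ n * ⁅x, y⁆ + ⁅x ^ n, y⁆ * x := by
      simp only [Ring.lie_def, pow_succ]
      noncomm_ring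
    have hpow : ‖x ^ n‖ ≤ δ ^ n :=
      (norm_pow_le x n).trans (pow_le_pow_left₀ (norm_nonneg x) hx n)
    calc ‖⁅x ^ (n + 1), y⁆‖ ≤ ‖x ^ n‖ * ‖⁅x, y⁆‖ + ‖⁅x ^ n, y⁆‖ * ‖x‖ := by
          rw [hsplit]
          exact (norm_add_le _ _).trans (add_le_add (norm_mul_le _ _) (norm_mul_le _ _))
      _ ≤ δ ^ n * ‖⁅x, y⁆‖ + n * δ ^ (n - 1) * ‖⁅x, y⁆‖ * δ := by gcongr
      _ = (n + 1 : ℕ) * δ ^ (n + 1 - 1) * ‖⁅x, y⁆‖ := by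
          rcases n with _ | n
          · simp
          · push_cast
            ring

theorem norm_lie_le_two_mul {A : Type*} [NormedRing A] (x y : A) :
    ‖⁅x, y⁆‖ ≤ 2 * ‖x‖ * ‖y‖ := by
  rw [Ring.lie_def]
  linarith [norm_sub_le (x * y) (y * x), norm_mul_le x y, norm_mul_le y x]

theorem summable_smul_pow_of_summable_deriv {A : Type*} [NormedRing A] [NormOneClass A]
    [NormedAlgebra ℂ A] [CompleteSpace A] {c : ℕ → ℂ} {δ : ℝ}
    (hc : Summable fun n : ℕ => (n : ℝ) * ‖c n‖ * δ ^ (n - 1)) {x : A} (hx : ‖x‖ ≤ δ) :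
    Summable fun n : ℕ => c n • x ^ n := by
  have hδ : 0 ≤ δ := (norm_nonneg x).trans hx
  rw [← summable_nat_add_iff 1]
  refine Summable.of_norm_bounded (((summable_nat_add_iff 1).2 hc).mul_left δ) fun n => ?_
  have hpow : ‖x ^ (n + 1)‖ ≤ δ ^ (n + 1) :=
    (norm_pow_le x _).trans (pow_le_pow_left₀ (norm_nonneg x) hx _)
  calc ‖c (n + 1) • x ^ (n + 1)‖ ≤ 1 * (‖c (n + 1)‖ * δ ^ (n + 1)) := by
        rw [norm_smul, one_mul]
        gcongr
    _ ≤ (n + 1 : ℕ) * (‖c (n + 1)‖ * δ ^ (n + 1)) := by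
        gcongr
        exact_mod_cast Nat.succ_pos n
    _ = δ * ((n + 1 : ℕ) * ‖c (n + 1)‖ * δ ^ (n + 1 - 1)) := by
        rw [Nat.add_sub_cancel]
        ring

/-- The commutator with a power series is controlled by the derivative of the majorant series. -/
theorem norm_lie_tsum_smul_pow_le {A : Type*} [NormedRing A] [NormOneClass A]
    [NormedAlgebra ℂ A] [CompleteSpace A] {c : ℕ → ℂ} {δ : ℝ}
    (hc : Summable fun n : ℕ => (n : ℝ) * ‖c n‖ * δ ^ (n - 1)) {x : A} (hx : ‖x‖ ≤ δ) (y : A) :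
    ‖⁅∑' n : ℕ, c n • x ^ n, y⁆‖ ≤
      (∑' n : ℕ, (n : ℝ) * ‖c n‖ * δ ^ (n - 1)) * ‖⁅x, y⁆‖ := by
  have hs := summable_smul_pow_of_summable_deriv hc hx
  have hlie : ⁅∑' n : ℕ, c n • x ^ n, y⁆ = ∑' n : ℕ, c n • ⁅x ^ n, y⁆ := by
    rw [Ring.lie_def, ← hs.tsum_mul_right, ← hs.tsum_mul_left,
      ← (hs.mul_right y).tsum_sub (hs.mul_left y)]
    simp only [Ring.lie_def, smul_sub, smul_mul_assoc, mul_smul_comm]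
  rw [hlie]
  refine tsum_of_norm_bounded (hc.hasSum.mul_right ‖⁅x, y⁆‖) fun n => ?_
  calc ‖c n • ⁅x ^ n, y⁆‖ ≤ ‖c n‖ * (n * δ ^ (n - 1) * ‖⁅x, y⁆‖) := by
        rw [norm_smul]
        gcongr
        exact norm_lie_pow_le hx y n
    _ = n * ‖c n‖ * δ ^ (n - 1) * ‖⁅x, y⁆‖ := by ring

theorem norm_average_le {A : Type*} [NormedRing A] [NormedAlgebra ℂ A] {N : ℕ} (hN : 1 ≤ N)
    {d : Fin N → A} {δ : ℝ} (hd : ∀ k, ‖d k‖ ≤ δ) : ‖(N : ℂ)⁻¹ • ∑ k, d k‖ ≤ δ := by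
  have hN' : (0 : ℝ) < N := by exact_mod_cast hN
  have hsum : ‖∑ k, d k‖ ≤ N * δ := by
    simpa using norm_sum_le_of_le Finset.univ fun k _ => hd k
  rw [norm_smul, norm_inv, Complex.norm_natCast, inv_mul_le_iff₀ hN']
  exact hsum

theorem norm_lie_average_le {A : Type*} [NormedRing A] [NormedAlgebra ℂ A] {N : ℕ}
    {d : Fin N → A} {δ : ℝ} (hd : ∀ k, ‖d k‖ ≤ δ) {y : A} {S : Finset (Fin N)}
    (hcomm : ∀ k ∉ S, ⁅d k, y⁆ = 0) :
    ‖⁅(N : ℂ)⁻¹ • ∑ k, d k, y⁆‖ ≤ 2 * S.card / N * ‖y‖ * δ := by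
  have hlie : ⁅(N : ℂ)⁻¹ • ∑ k, d k, y⁆ = (N : ℂ)⁻¹ • ∑ k ∈ S, ⁅d k, y⁆ := by
    rw [Finset.sum_subset S.subset_univ fun k _ hk => hcomm k hk]
    simp only [Ring.lie_def, Finset.sum_sub_distrib, smul_sub, Finset.sum_mul, Finset.mul_sum,
      smul_mul_assoc, mul_smul_comm]
  have hsum : ‖∑ k ∈ S, ⁅d k, y⁆‖ ≤ S.card * (2 * δ * ‖y‖) := by
    have h := norm_sum_le_of_le S fun k _ => (norm_lie_le_two_mul (d k) y).trans
      (show 2 * ‖d k‖ * ‖y‖ ≤ 2 * δ * ‖y‖ by gcongr; exact hd k)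
    simpa using h
  calc ‖⁅(N : ℂ)⁻¹ • ∑ k, d k, y⁆‖ ≤ (N : ℝ)⁻¹ * (S.card * (2 * δ * ‖y‖)) := by
        rw [hlie, norm_smul, norm_inv, Complex.norm_natCast]
        gcongr
    _ = 2 * S.card / N * ‖y‖ * δ := by ring

/-- Bound on the commutator of an operator-valued function `Γ(Δ_N)` of an average
operator with a strictly local operator `O` supported on `N_O` sites. -/
theorem commutator_operator_valued_function_local_bound
    {A : Type*} [NormedRing A] [NormOneClass A] [NormedAlgebra ℂ A] [CompleteSpace A]
    (c : ℕ → ℂ) (δ : ℝ) (hδ : 0 < δ)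
    (hγ' : Summable fun n : ℕ => (n : ℝ) * ‖c n‖ * δ ^ (n - 1))
    (N : ℕ) (hN : 1 ≤ N) (d : Fin N → A) (hd : ∀ k, ‖d k‖ ≤ δ)
    (O : A) (NO : ℕ) (S : Finset (Fin N)) (hScard : S.card = NO)
    (hcomm : ∀ k ∉ S, ⁅d k, O⁆ = 0) :
    ‖⁅∑' n : ℕ, c n • ((N : ℂ)⁻¹ • ∑ k, d k) ^ n, O⁆‖ ≤
      2 * NO / N * ‖O‖ * (δ * ∑' n : ℕ, (n : ℝ) * ‖c n‖ * δ ^ (n - 1)) := by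
  subst hScard
  have hsum_nonneg : 0 ≤ ∑' n : ℕ, (n : ℝ) * ‖c n‖ * δ ^ (n - 1) :=
    tsum_nonneg fun n => by positivity
  refine (norm_lie_tsum_smul_pow_le hγ' (norm_average_le hN hd) O).trans ?_
  refine (mul_le_mul_of_nonneg_left (norm_lie_average_le hd hcomm) hsum_nonneg).trans_eq ?_
  ring
end

section
/- Let A be a unital C*-algebra and let ω : A → ℂ be a state (linear, ω(1) = 1, ω(a*a) ≥ 0 for all a). Let (Y_N)_{N≥1} be a sequence of self-adjoint elements of A such that ω(Y_N²) → 0 as N → ∞, and such that for every A₀ ∈ A the commutator norm ‖[Y_N, A₀]‖ → 0 as N → ∞. Then for all A₀, B ∈ A one has ω(A₀* Y_N B) → 0 as N → ∞; i.e., Y_N converges weakly (in the sense of matrix elements against the state ω) to 0. -/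
open scoped ComplexOrder
open Filter Topology

namespace PositiveLinearMap

variable {A : Type*} [CStarAlgebra A] [PartialOrder A] [StarOrderedRing A]

/-- The Cauchy–Schwarz inequality for a positive linear functional on a C⋆-algebra. -/
theorem norm_apply_star_mul_le (f : A →ₚ[ℂ] ℂ) (a b : A) :
    ‖f (star a * b)‖ ≤ √(f (star a * a)).re * √(f (star b * b)).re := by
  simpa [preGNS_inner_def, preGNS_norm_def] using
    norm_inner_le_norm (𝕜 := ℂ) (f.toPreGNS a) (f.toPreGNS b)

/-- If `f (star (y i) * y i)` tends to `0`, then so does `f (a * y i)` for every `a`. -/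
theorem tendsto_apply_mul_zero {ι : Type*} {l : Filter ι} (f : A →ₚ[ℂ] ℂ) {y : ι → A}
    (hy : Tendsto (fun i => f (star (y i) * y i)) l (𝓝 0)) (a : A) :
    Tendsto (fun i => f (a * y i)) l (𝓝 0) := by
  refine squeeze_zero_norm
    (fun i => by simpa using f.norm_apply_star_mul_le (star a) (y i)) ?_
  have hsqrt : Tendsto (fun i => √(f (star (y i) * y i)).re) l (𝓝 0) := by
    simpa using ((Complex.continuous_re.tendsto 0).comp hy).sqrt
  simpa using hsqrt.const_mul √(f (a * star a)).re

/-- If `f (star (y i) * y i)` tends to `0` and `y` asymptotically commutes with `b`, then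
`f (a * y i * b)` tends to `0`. -/
theorem tendsto_apply_mul_mul_zero {ι : Type*} {l : Filter ι} (f : A →ₚ[ℂ] ℂ) {y : ι → A}
    (hy : Tendsto (fun i => f (star (y i) * y i)) l (𝓝 0)) (a : A) {b : A}
    (hb : Tendsto (fun i => ⁅y i, b⁆) l (𝓝 0)) :
    Tendsto (fun i => f (a * y i * b)) l (𝓝 0) := by
  have hf : Continuous f := map_continuous f
  have hcomm : Tendsto (fun i => f (a * ⁅y i, b⁆)) l (𝓝 0) := by
    simpa [Function.comp_def] using (hf.tendsto _).comp (hb.const_mul a)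
  have hsum := (f.tendsto_apply_mul_zero hy (a * b)).add hcomm
  rw [add_zero] at hsum
  refine hsum.congr fun i => ?_
  rw [← map_add, Ring.lie_def]
  congr 1
  noncomm_ring

end PositiveLinearMap

/-- If self-adjoint elements `Y_N` have vanishing variance in the state `ω` and
asymptotically commute (in norm) with every element, then they converge weakly
(in the sense of matrix elements against `ω`) to `0`. -/
theorem vanishing_variance_implies_weak_convergence
    {A : Type*} [NormedRing A] [StarRing A] [CStarRing A]
    [NormedAlgebra ℂ A] [StarModule ℂ A] [CompleteSpace A]
    (ω : A →ₗ[ℂ] ℂ) (hω1 : ω 1 = 1) (hωpos : ∀ a : A, 0 ≤ ω (star a * a))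
    (Y : ℕ → A) (hsa : ∀ N, IsSelfAdjoint (Y N))
    (hvar : Tendsto (fun N => ω (Y N * Y N)) atTop (𝓝 0))
    (hcomm : ∀ A₀ : A, Tendsto (fun N => ‖⁅Y N, A₀⁆‖) atTop (𝓝 0)) :
    ∀ A₀ B : A, Tendsto (fun N => ω (star A₀ * Y N * B)) atTop (𝓝 0) := by
  intro A₀ B
  let _ : CStarAlgebra A := {}
  let _ : PartialOrder A := CStarAlgebra.spectralOrder A
  have : StarOrderedRing A := CStarAlgebra.spectralOrderedRing A
  let f : A →ₚ[ℂ] ℂ := .mk₀ ω fun a ha => by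
    obtain ⟨b, rfl⟩ := CStarAlgebra.nonneg_iff_eq_star_mul_self.mp ha
    exact hωpos b
  have hf : Tendsto (fun N => f (star (Y N) * Y N)) atTop (𝓝 0) :=
    hvar.congr fun N => by rw [(hsa N).star_eq]; rfl
  exact f.tendsto_apply_mul_mul_zero hf (star A₀) (tendsto_zero_iff_norm_tendsto_zero.mpr (hcomm B))
end

section
/- Let β, Ω ∈ ℝ with β > 1 + 8Ω². Then there exists x ∈ (0, 1) satisfying the retrieval self-consistency equation (1 + 8Ω² / cosh²(βx)) · x = tanh(βx); i.e., the stationary mean-field equations of the quantum Hopfield network admit a nonzero (ferromagnetic/retrieval) solution. -/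
open Filter Topology in
/-- Near zero the left side of the retrieval equation lies below `tanh (β * x)`. -/
lemma exists_retrieval_lt_tanh {β a : ℝ} (ha : 0 ≤ a) (h : 1 + a < β) :
    ∃ x : ℝ, 0 < x ∧ x < 1 ∧
      (1 + a / Real.cosh (β * x) ^ 2) * x < Real.tanh (β * x) := by
  have hcont : Continuous fun x : ℝ => Real.cosh (β * x) + a / Real.cosh (β * x) := by
    have hc : Continuous fun x : ℝ => Real.cosh (β * x) := by fun_prop
    exact hc.add (continuous_const.div hc fun x => (Real.cosh_pos _).ne')
  have hnear : ∀ᶠ x in 𝓝[>] (0 : ℝ), Real.cosh (β * x) + a / Real.cosh (β * x) < β :=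
    (hcont.continuousAt.eventually_lt continuousAt_const (by simpa using h)).filter_mono
      nhdsWithin_le_nhds
  obtain ⟨x, hx, hx0, hx1⟩ :=
    (hnear.and (Ioo_mem_nhdsGT (zero_lt_one' ℝ))).exists
  refine ⟨x, hx0, hx1, ?_⟩
  have hc := Real.cosh_pos (β * x)
  have hs : β * x ≤ Real.sinh (β * x) :=
    Real.self_le_sinh_iff.2 (mul_nonneg (by linarith) hx0.le)
  rw [Real.tanh_eq_sinh_div_cosh, lt_div_iff₀ hc]
  calc (1 + a / Real.cosh (β * x) ^ 2) * x * Real.cosh (β * x)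
      = (Real.cosh (β * x) + a / Real.cosh (β * x)) * x := by field_simp
    _ < β * x := mul_lt_mul_of_pos_right hx hx0
    _ ≤ Real.sinh (β * x) := hs

/-- For `β > 1 + 8Ω²`, the retrieval self-consistency equation of the quantum
Hopfield network admits a nonzero stationary overlap `x ∈ (0, 1)`. -/
theorem hopfield_retrieval_solution_exists (β Ω : ℝ) (h : β > 1 + 8 * Ω ^ 2) :
    ∃ x : ℝ, 0 < x ∧ x < 1 ∧
      (1 + 8 * Ω ^ 2 / Real.cosh (β * x) ^ 2) * x = Real.tanh (β * x) := by
  obtain ⟨y, hy0, hy1, hy⟩ := exists_retrieval_lt_tanh (by positivity) h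
  have htanh : Continuous fun x : ℝ => Real.tanh (β * x) := by
    simp only [Real.tanh_eq_sinh_div_cosh]
    exact Continuous.div (by fun_prop) (by fun_prop) fun x => (Real.cosh_pos _).ne'
  have hleft : Continuous fun x : ℝ => (1 + 8 * Ω ^ 2 / Real.cosh (β * x) ^ 2) * x :=
    (continuous_const.add (continuous_const.div (by fun_prop)
      fun x => (pow_pos (Real.cosh_pos _) 2).ne')).mul continuous_id
  have hone : 0 < (1 + 8 * Ω ^ 2 / Real.cosh (β * 1) ^ 2) * 1 - Real.tanh (β * 1) := by
    have h1 := Real.tanh_lt_one (β * 1)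
    have h2 : 0 ≤ 8 * Ω ^ 2 / Real.cosh (β * 1) ^ 2 := by positivity
    linarith
  obtain ⟨x, ⟨hyx, hx1⟩, hx⟩ :=
    intermediate_value_Ioo hy1.le (hleft.sub htanh).continuousOn ⟨sub_neg.2 hy, hone⟩
  exact ⟨x, hy0.trans hyx, hx1, sub_eq_zero.1 hx⟩
end

section
/- Let β, Ω ∈ ℝ with 0 ≤ β ≤ 1. Then the only real solution x of the retrieval self-consistency equation (1 + 8Ω² / cosh²(βx)) · x = tanh(βx) is x = 0; i.e., at high temperature the mean-field equations of the quantum Hopfield network admit only the vanishing (paramagnetic) stationary overlap. -/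
theorem Real.sinh_lt_mul_cosh {y : ℝ} (hy : 0 < y) : Real.sinh y < y * Real.cosh y := by
  have hd (t : ℝ) : HasDerivAt (fun t ↦ t * Real.cosh t - Real.sinh t) (t * Real.sinh t) t := by
    refine (((hasDerivAt_id' t).mul (Real.hasDerivAt_cosh t)).sub
      (Real.hasDerivAt_sinh t)).congr_deriv ?_
    ring
  have hmono : StrictMonoOn (fun t ↦ t * Real.cosh t - Real.sinh t) (Set.Ici 0) := by
    refine strictMonoOn_of_deriv_pos (convex_Ici 0)
      (fun t _ ↦ (hd t).continuousAt.continuousWithinAt) fun t ht ↦ ?_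
    rw [interior_Ici, Set.mem_Ioi] at ht
    rw [(hd t).deriv]
    exact mul_pos ht (Real.sinh_pos_iff.2 ht)
  have h := hmono Set.self_mem_Ici hy.le hy
  simp only [Real.sinh_zero, zero_mul, sub_zero] at h
  linarith

theorem Real.tanh_lt_self {y : ℝ} (hy : 0 < y) : Real.tanh y < y := by
  rw [Real.tanh_eq_sinh_div_cosh, div_lt_iff₀ (Real.cosh_pos y)]
  exact Real.sinh_lt_mul_cosh hy

theorem Real.tanh_mul_lt_self {β x : ℝ} (h0 : 0 ≤ β) (h1 : β ≤ 1) (hx : 0 < x) :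
    Real.tanh (β * x) < x := by
  rcases h0.eq_or_lt with rfl | hβ
  · simpa using hx
  · exact (Real.tanh_lt_self (mul_pos hβ hx)).trans_le (mul_le_of_le_one_left hx.le h1)

/-- For `0 ≤ β ≤ 1` (high temperature), the only stationary overlap of the quantum
Hopfield mean-field equations is the vanishing, paramagnetic one. -/
theorem hopfield_paramagnetic_only_solution (β Ω : ℝ) (h0 : 0 ≤ β) (h1 : β ≤ 1) :
    ∀ x : ℝ, (1 + 8 * Ω ^ 2 / Real.cosh (β * x) ^ 2) * x = Real.tanh (β * x) → x = 0 := by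
  intro x h
  have hc : 0 ≤ 8 * Ω ^ 2 / Real.cosh (β * x) ^ 2 := by positivity
  rcases lt_trichotomy x 0 with hx | hx | hx
  · have ht := Real.tanh_mul_lt_self h0 h1 (neg_pos.2 hx)
    rw [mul_neg, Real.tanh_neg] at ht
    linarith [mul_nonpos_of_nonneg_of_nonpos hc hx.le]
  · exact hx
  · linarith [Real.tanh_mul_lt_self h0 h1 hx, mul_nonneg hc hx.le]
end
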